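/- Let q, n ≥ 0 and let μ, λ ∈ V_{q+n} both satisfy conditions (h1), (h3) and (h4). Suppose h ∈ GL_{q+n}(ℝ) satisfies h.μ = λ and h(ℝ^q) ⊆ ℝ^q. Then h has block upper-triangular form h = [[h_q, A],[0, h_n]] with respect to ℝ^{q+n} = ℝ^q ⊕ ℝ^n (with h_q ∈ GL_q(ℝ), h_n ∈ GL_n(ℝ), A : ℝ^n → ℝ^q linear), and moreover: (a) A ∘ (ad_μ z|_{ℝ^n}) = h_q ∘ (ad_μ z|_{ℝ^q}) ∘ h_q⁻¹ ∘ A for every z ∈ ℝ^q, and (b) h_nᵀ h_n commutes with ad_μ z|_{ℝ^n} for every z ∈ ℝ^q. -/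

import Mathlib

open scoped BigOperators

noncomputable section

/-- Euclidean space `ℝ^m` as functions `Fin m → ℝ`. -/
abbrev Eu (m : ℕ) := Fin m → ℝ

/-- The space of bilinear maps `ℝ^{q+n} × ℝ^{q+n} → ℝ^{q+n}`. -/
abbrev Bil (q n : ℕ) := Eu (q + n) →ₗ[ℝ] Eu (q + n) →ₗ[ℝ] Eu (q + n)

/-- Skew-symmetry: membership in `V_{q+n}`. -/
def Skew (q n : ℕ) (μ : Bil q n) : Prop := ∀ x y, μ x y = - μ y x

/-- Membership in the `ℝ^q`-factor (first `q` coordinates). -/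
def inK (q n : ℕ) (x : Eu (q + n)) : Prop := ∀ i : Fin (q + n), q ≤ (i : ℕ) → x i = 0

/-- Membership in the `ℝ^n`-factor (last `n` coordinates). -/
def inP (q n : ℕ) (x : Eu (q + n)) : Prop := ∀ i : Fin (q + n), (i : ℕ) < q → x i = 0

/-- The canonical inner product. -/
def dotE (m : ℕ) (x y : Eu m) : ℝ := ∑ i, x i * y i

/-- Condition (h1): Jacobi identity, `μ(ℝ^q,ℝ^q) ⊆ ℝ^q` and `μ(ℝ^q,ℝ^n) ⊆ ℝ^n`. -/
def H1 (q n : ℕ) (μ : Bil q n) : Prop :=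
  (∀ x y z, μ x (μ y z) + μ y (μ z x) + μ z (μ x y) = 0) ∧
  (∀ x y, inK q n x → inK q n y → inK q n (μ x y)) ∧
  (∀ x y, inK q n x → inP q n y → inP q n (μ x y))

/-- Condition (h3): `ad_μ z|_{ℝ^n}` is skew-symmetric for every `z ∈ ℝ^q`. -/
def H3 (q n : ℕ) (μ : Bil q n) : Prop :=
  ∀ z x y, inK q n z → inP q n x → inP q n y →
    dotE (q + n) (μ z x) y = - dotE (q + n) x (μ z y)

/-- Condition (h4): almost-effectiveness. -/
def H4 (q n : ℕ) (μ : Bil q n) : Prop :=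
  ∀ z, inK q n z → (∀ x, inP q n x → μ z x = 0) → z = 0

/-- Inclusion `ℝ^q → ℝ^{q+n}` onto the first `q` coordinates. -/
def emK (q n : ℕ) : Eu q →ₗ[ℝ] Eu (q + n) where
  toFun z := fun i => if h : (i : ℕ) < q then z ⟨i, h⟩ else 0
  map_add' x y := by funext i; by_cases h : (i : ℕ) < q <;> simp [h]
  map_smul' c x := by funext i; by_cases h : (i : ℕ) < q <;> simp [h]

/-- Inclusion `ℝ^n → ℝ^{q+n}` onto the last `n` coordinates. -/
def emP (q n : ℕ) : Eu n →ₗ[ℝ] Eu (q + n) where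
  toFun x := fun i => if h : q ≤ (i : ℕ) then x ⟨(i : ℕ) - q, by have := i.isLt; omega⟩ else 0
  map_add' x y := by funext i; by_cases h : q ≤ (i : ℕ) <;> simp [h]
  map_smul' c x := by funext i; by_cases h : q ≤ (i : ℕ) <;> simp [h]

/-- Projection `ℝ^{q+n} → ℝ^q` (first `q` coordinates). -/
def prK (q n : ℕ) : Eu (q + n) →ₗ[ℝ] Eu q where
  toFun v := fun i => v ⟨(i : ℕ), by have := i.isLt; omega⟩
  map_add' x y := rfl
  map_smul' c x := rfl

/-- Projection `ℝ^{q+n} → ℝ^n` (last `n` coordinates). -/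
def prP (q n : ℕ) : Eu (q + n) →ₗ[ℝ] Eu n where
  toFun v := fun i => v ⟨q + (i : ℕ), by have := i.isLt; omega⟩
  map_add' x y := rfl
  map_smul' c x := rfl

/-- The restriction `ad_μ z|_{ℝ^n} : ℝ^n → ℝ^n` for `z ∈ ℝ^q`. -/
def restAdP (q n : ℕ) (μ : Bil q n) (z : Eu q) : Eu n →ₗ[ℝ] Eu n :=
  (prP q n) ∘ₗ (μ (emK q n z)) ∘ₗ (emP q n)

/-- The restriction `ad_μ z|_{ℝ^q} : ℝ^q → ℝ^q` for `z ∈ ℝ^q`. -/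
def restAdK (q n : ℕ) (μ : Bil q n) (z : Eu q) : Eu q →ₗ[ℝ] Eu q :=
  (prK q n) ∘ₗ (μ (emK q n z)) ∘ₗ (emK q n)

/-- Transpose of an endomorphism of `ℝ^n` with respect to the canonical basis. -/
def tmap (n : ℕ) (f : Eu n →ₗ[ℝ] Eu n) : Eu n →ₗ[ℝ] Eu n :=
  Matrix.toLin' (LinearMap.toMatrix' f).transpose

/-- The `GL_{q+n}(ℝ)`-action `(h.μ)(x,y) = h μ(h⁻¹x, h⁻¹y)` on brackets. -/
def act (q n : ℕ) (h : Eu (q + n) ≃ₗ[ℝ] Eu (q + n)) (μ : Bil q n) : Bil q n :=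
  ((μ.comp h.symm.toLinearMap).compl₂ h.symm.toLinearMap).compr₂ h.toLinearMap

@[simp] lemma prK_emK (q n : ℕ) (z : Eu q) : prK q n (emK q n z) = z := by
  funext i
  simp [prK, emK]

@[simp] lemma prP_emP (q n : ℕ) (x : Eu n) : prP q n (emP q n x) = x := by
  funext i
  simp [prP, emP]

@[simp] lemma prP_emK (q n : ℕ) (z : Eu q) : prP q n (emK q n z) = 0 := by
  funext i
  simp [prP, emK]

@[simp] lemma prK_emP (q n : ℕ) (x : Eu n) : prK q n (emP q n x) = 0 := by
  funext i
  simp [prK, emP]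

lemma emK_prK_add_emP_prP (q n : ℕ) (x : Eu (q + n)) :
    emK q n (prK q n x) + emP q n (prP q n x) = x := by
  funext i
  by_cases hi : (i : ℕ) < q
  · simp [emK, emP, prK, hi]
  · have hq : q ≤ (i : ℕ) := not_lt.mp hi
    simp [emK, emP, prP, hi, hq]

lemma inK_emK (q n : ℕ) (z : Eu q) : inK q n (emK q n z) := fun i hi => by
  simp [emK, not_lt.mpr hi]

lemma inP_emP (q n : ℕ) (x : Eu n) : inP q n (emP q n x) := fun i hi => by
  simp [emP, not_le.mpr hi]

lemma prP_eq_zero_of_inK {q n : ℕ} {x : Eu (q + n)} (hx : inK q n x) : prP q n x = 0 := by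
  funext i
  exact hx _ (by simp)

lemma prK_eq_zero_of_inP {q n : ℕ} {x : Eu (q + n)} (hx : inP q n x) : prK q n x = 0 := by
  funext i
  exact hx _ (by simp)

lemma emK_prK_of_inK {q n : ℕ} {x : Eu (q + n)} (hx : inK q n x) :
    emK q n (prK q n x) = x := by
  simpa [prP_eq_zero_of_inK hx] using emK_prK_add_emP_prP q n x

lemma emP_prP_of_inP {q n : ℕ} {x : Eu (q + n)} (hx : inP q n x) :
    emP q n (prP q n x) = x := by
  simpa [prK_eq_zero_of_inP hx] using emK_prK_add_emP_prP q n x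

lemma dotE_emP (q n : ℕ) (v : Eu (q + n)) (y : Eu n) :
    dotE (q + n) v (emP q n y) = dotE n (prP q n v) y := by
  have hlt (i : Fin q) : ¬ q ≤ (i : ℕ) := not_le.mpr i.isLt
  simp [dotE, Fin.sum_univ_add, emP, prP, Fin.natAdd, hlt]

lemma dotE_comm (m : ℕ) (x y : Eu m) : dotE m x y = dotE m y x := by
  simp [dotE, mul_comm]

lemma dotE_single (m : ℕ) (x : Eu m) (i : Fin m) : dotE m x (Pi.single i 1) = x i := by
  simp [dotE, Pi.single_apply]

lemma emK_restAdK {q n : ℕ} {μ : Bil q n} (h1 : H1 q n μ) (z w : Eu q) :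
    emK q n (restAdK q n μ z w) = μ (emK q n z) (emK q n w) :=
  emK_prK_of_inK (h1.2.1 _ _ (inK_emK q n z) (inK_emK q n w))

lemma emP_restAdP {q n : ℕ} {μ : Bil q n} (h1 : H1 q n μ) (z : Eu q) (x : Eu n) :
    emP q n (restAdP q n μ z x) = μ (emK q n z) (emP q n x) :=
  emP_prP_of_inP (h1.2.2 _ _ (inK_emK q n z) (inP_emP q n x))

lemma tmap_restAdP {q n : ℕ} {μ : Bil q n} (h3 : H3 q n μ) (z : Eu q) :
    tmap n (restAdP q n μ z) = -restAdP q n μ z := by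
  have hskew : (LinearMap.toMatrix' (restAdP q n μ z)).transpose
      = -LinearMap.toMatrix' (restAdP q n μ z) := by
    ext i j
    have := h3 (emK q n z) (emP q n (Pi.single i 1)) (emP q n (Pi.single j 1))
      (inK_emK q n z) (inP_emP q n _) (inP_emP q n _)
    rw [dotE_emP, dotE_comm (q + n), dotE_emP, dotE_single, dotE_single] at this
    simpa [LinearMap.toMatrix'_apply, restAdP] using this
  rw [tmap, hskew, map_neg, Matrix.toLin'_toMatrix']

lemma tmap_comp (n : ℕ) (f g : Eu n →ₗ[ℝ] Eu n) :
    tmap n (f ∘ₗ g) = tmap n g ∘ₗ tmap n f := by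
  simp [tmap, LinearMap.toMatrix'_comp, Matrix.transpose_mul, Matrix.toLin'_mul]

lemma tmap_comp_self_commute {n : ℕ} {f S T : Eu n →ₗ[ℝ] Eu n}
    (hS : tmap n S = -S) (hT : tmap n T = -T) (hfS : f ∘ₗ S = T ∘ₗ f) :
    (tmap n f ∘ₗ f) ∘ₗ S = S ∘ₗ (tmap n f ∘ₗ f) := by
  have ht : S ∘ₗ tmap n f = tmap n f ∘ₗ T := by
    have := congrArg (tmap n) hfS
    rw [tmap_comp, tmap_comp, hS, hT, LinearMap.neg_comp, LinearMap.comp_neg] at this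
    exact neg_injective this
  rw [LinearMap.comp_assoc, hfS, ← LinearMap.comp_assoc, ← ht, LinearMap.comp_assoc]

/-- cf. Proposition 3.8 of the paper: any `h ∈ GL_{q+n}(ℝ)` carrying a
bracket satisfying (h1), (h3), (h4) to another such bracket and preserving `ℝ^q` is block
upper-triangular and satisfies the compatibility conditions (a) and (b). -/
theorem block_triangular_of_act_eq
    (q n : ℕ) (μ lam : Bil q n) (hμ : Skew q n μ) (hlam : Skew q n lam)
    (h1μ : H1 q n μ) (h3μ : H3 q n μ) (h4μ : H4 q n μ)
    (h1lam : H1 q n lam) (h3lam : H3 q n lam) (h4lam : H4 q n lam)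
    (h : Eu (q + n) ≃ₗ[ℝ] Eu (q + n))
    (hact : act q n h μ = lam)
    (hK : ∀ x, inK q n x → inK q n (h x)) :
    ∃ (hq : Eu q ≃ₗ[ℝ] Eu q) (hn : Eu n ≃ₗ[ℝ] Eu n) (A : Eu n →ₗ[ℝ] Eu q),
      (∀ x, h x = emK q n (hq (prK q n x) + A (prP q n x)) + emP q n (hn (prP q n x))) ∧
      (∀ z : Eu q,
        A ∘ₗ restAdP q n μ z
          = hq.toLinearMap ∘ₗ restAdK q n μ z ∘ₗ hq.symm.toLinearMap ∘ₗ A) ∧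
      (∀ z : Eu q,
        (tmap n hn.toLinearMap ∘ₗ hn.toLinearMap) ∘ₗ restAdP q n μ z
          = restAdP q n μ z ∘ₗ (tmap n hn.toLinearMap ∘ₗ hn.toLinearMap)) := by
  have hbr : ∀ x y, h (μ x y) = lam (h x) (h y) := fun x y => by
    simp [← hact, act]
  have hqK : ∀ z, emK q n (prK q n (h (emK q n z))) = h (emK q n z) := fun z =>
    emK_prK_of_inK (hK _ (inK_emK q n z))
  let hq : Eu q ≃ₗ[ℝ] Eu q :=
    LinearEquiv.ofInjectiveEndo (prK q n ∘ₗ h.toLinearMap ∘ₗ emK q n) <| by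
      refine (injective_iff_map_eq_zero _).2 fun z hz => ?_
      have h0 : h (emK q n z) = 0 := by
        rw [← hqK z]
        exact (congrArg (emK q n) hz).trans (map_zero _)
      rw [← prK_emK q n z, (map_eq_zero_iff h h.injective).1 h0, map_zero]
  have hhq : ∀ z, h (emK q n z) = emK q n (hq z) := fun z => (hqK z).symm
  let A : Eu n →ₗ[ℝ] Eu q := prK q n ∘ₗ h.toLinearMap ∘ₗ emP q n
  let hn : Eu n ≃ₗ[ℝ] Eu n :=
    LinearEquiv.ofInjectiveEndo (prP q n ∘ₗ h.toLinearMap ∘ₗ emP q n) <| by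
      refine (injective_iff_map_eq_zero _).2 fun x hx => ?_
      have hx' : prP q n (h (emP q n x)) = 0 := hx
      have hdec := emK_prK_add_emP_prP q n (h (emP q n x))
      rw [hx', map_zero, add_zero, ← hq.apply_symm_apply (prK q n (h (emP q n x))),
        ← hhq] at hdec
      rw [← prP_emP q n x, ← h.injective hdec, prP_emK]
  have hhn : ∀ x, h (emP q n x) = emK q n (A x) + emP q n (hn x) := fun x =>
    (emK_prK_add_emP_prP q n (h (emP q n x))).symm
  have hmain : ∀ z x, emK q n (A (restAdP q n μ z x)) + emP q n (hn (restAdP q n μ z x))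
      = emK q n (restAdK q n lam (hq z) (A x)) + emP q n (restAdP q n lam (hq z) (hn x)) := by
    intro z x
    rw [← hhn, emP_restAdP h1μ, hbr, hhq, hhn, map_add, emK_restAdK h1lam, emP_restAdP h1lam]
  have hqad : ∀ z w, hq (restAdK q n μ z w) = restAdK q n lam (hq z) (hq w) := by
    intro z w
    rw [← prK_emK q n (hq _), ← hhq, emK_restAdK h1μ, hbr, hhq, hhq, ← emK_restAdK h1lam,
      prK_emK]
  refine ⟨hq, hn, A, fun x => ?_, fun z => ?_, fun z => ?_⟩
  · conv_lhs => rw [← emK_prK_add_emP_prP q n x]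
    rw [map_add, hhq, hhn, map_add, add_assoc]
  · refine LinearMap.ext fun x => ?_
    have := congrArg (prK q n) (hmain z x)
    simp only [map_add, prK_emK, prK_emP, add_zero] at this
    simp [this, hqad]
  · refine tmap_comp_self_commute (tmap_restAdP h3μ z) (tmap_restAdP h3lam (hq z)) ?_
    refine LinearMap.ext fun x => ?_
    have := congrArg (prP q n) (hmain z x)
    simp only [map_add, prP_emK, prP_emP, zero_add] at this
    exact this
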